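/- Let f_1,…,f_s ∈ R be homogeneous polynomials such that every subset of at most c+1 of them is an R-regular sequence, where 1 ≤ c ≤ min(n,s). Then for every positive integer m, the m-th symbolic power of the configuration ideal I_{V_{λ,c}} = ⋂_{1≤i_1<⋯<i_c≤s} (f_{i_1},…,f_{i_c}) satisfies I_{V_{λ,c}}^{(m)} = ⋂_{1≤i_1<⋯<i_c≤s} (f_{i_1},…,f_{i_c})^m, and R/I_{V_{λ,c}}^{(m)} is Cohen–Macaulay; moreover I_{V_{λ,c}}^{(m)} is generated by monomials in the f_i. -/

import Mathlib

/- ------------------------------------------------------------------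
   Common definitions
------------------------------------------------------------------ -/

open MvPolynomial CategoryTheory

noncomputable section

/-- The height of an ideal: the infimum of the heights of the prime ideals containing it. -/
noncomputable def idealHeight {A : Type*} [CommRing A] (I : Ideal A) : ℕ∞ :=
  ⨅ P ∈ {P : PrimeSpectrum A | I ≤ P.asIdeal}, Order.height P

/-- The depth of a module `M` with respect to an ideal `J`: the supremum of the lengths of
`M`-regular sequences consisting of elements of `J`. -/
noncomputable def idealDepth {A : Type*} [CommRing A] (J : Ideal A)
    (M : Type*) [AddCommGroup M] [Module A M] : ℕ∞ :=
  sSup {n : ℕ∞ | ∃ rs : List A, (rs.length : ℕ∞) = n ∧ (∀ r ∈ rs, r ∈ J) ∧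
    RingTheory.Sequence.IsRegular M rs}

/-- The irrelevant maximal ideal `(x_i : i ∈ σ)` of the polynomial ring `k[x_i : i ∈ σ]`. -/
def irrelevantIdeal (k : Type) [Field k] (σ : Type) : Ideal (MvPolynomial σ k) :=
  Ideal.span (Set.range (X : σ → MvPolynomial σ k))

/-- The quotient of a polynomial ring by an ideal `I` is Cohen–Macaulay if its depth with
respect to the irrelevant maximal ideal equals its Krull dimension. -/
def IsCMQuotient {k : Type} [Field k] {σ : Type} (I : Ideal (MvPolynomial σ k)) : Prop :=
  (idealDepth (irrelevantIdeal k σ) (MvPolynomial σ k ⧸ I) : WithBot ℕ∞)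
    = ringKrullDim (MvPolynomial σ k ⧸ I)

/-- An ideal of a polynomial ring is homogeneous if it contains all homogeneous components
of each of its elements. -/
def IsHomogeneousIdeal {k : Type} [Field k] {σ : Type} (I : Ideal (MvPolynomial σ k)) : Prop :=
  ∀ p ∈ I, ∀ i : ℕ, homogeneousComponent i p ∈ I

/-- The Hilbert function of `R/I`, `t ↦ dim_k [R/I]_t`, as a function `ℤ → ℤ`
(equal to `0` in negative degrees). -/
noncomputable def hilbertFn (k : Type) [Field k] {σ : Type} (I : Ideal (MvPolynomial σ k))
    (t : ℤ) : ℤ :=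
  if t < 0 then 0
  else
    (Module.finrank k (homogeneousSubmodule σ k t.toNat) : ℤ) -
    (Module.finrank k
      ((Submodule.restrictScalars k (I : Submodule (MvPolynomial σ k) (MvPolynomial σ k))) ⊓
        homogeneousSubmodule σ k t.toNat : Submodule k (MvPolynomial σ k)) : ℤ)

/-- `P` is the Hilbert polynomial of `R/I` if it agrees with the Hilbert function of `R/I`
in all sufficiently large degrees. -/
def IsHilbertPolyOf (k : Type) [Field k] {σ : Type} (I : Ideal (MvPolynomial σ k))
    (P : Polynomial ℚ) : Prop :=
  ∃ N : ℤ, ∀ t : ℤ, N ≤ t → (hilbertFn k I t : ℚ) = P.eval (t : ℚ)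

open Classical in
/-- The Hilbert polynomial of `R/I` (defined as `0` if none exists). -/
noncomputable def hilbertPoly (k : Type) [Field k] {σ : Type} (I : Ideal (MvPolynomial σ k)) :
    Polynomial ℚ :=
  if h : ∃ P : Polynomial ℚ, IsHilbertPolyOf k I P then h.choose else 0

/-- The multiplicity (degree) `e(R/I)`: `(δ-1)!` times the leading coefficient of the Hilbert
polynomial of `R/I`, whose degree is `δ - 1` where `δ = dim R/I ≥ 1`. -/
noncomputable def multiplicityDeg (k : Type) [Field k] {σ : Type}
    (I : Ideal (MvPolynomial σ k)) : ℚ :=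
  (Nat.factorial (hilbertPoly k I).natDegree) * (hilbertPoly k I).leadingCoeff

/-- The `m`-th symbolic power of an ideal `J`:
`J^{(m)} = ⋂_{P ∈ Ass(A/J)} (J^m A_P ∩ A)`. -/
noncomputable def symbolicPower {A : Type*} [CommRing A] (J : Ideal A) (m : ℕ) : Ideal A :=
  sInf { K : Ideal A | ∃ (P : Ideal A) (hP : IsAssociatedPrime P (A ⧸ J)),
    K = Ideal.comap (algebraMap A (Localization (@Ideal.primeCompl A _ P hP.1)))
          (Ideal.map (algebraMap A (Localization (@Ideal.primeCompl A _ P hP.1))) (J ^ m)) }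

/-- `α(I)`: the least degree of a nonzero form in `I`. -/
noncomputable def alphaDeg (k : Type) [Field k] {σ : Type} (I : Ideal (MvPolynomial σ k)) : ℕ :=
  sInf {d : ℕ | ∃ p ∈ I, p ≠ 0 ∧ MvPolynomial.IsHomogeneous p d}

/-- `dim_k Tor_i^A(M, N)`, the rank over the base field `k` of the Tor module. -/
noncomputable def torRank (k : Type) [Field k] (A : Type) [CommRing A] [Algebra k A]
    (M N : Type) [AddCommGroup M] [Module A M] [AddCommGroup N] [Module A N] (i : ℕ) :
    Cardinal :=
  Module.rank k (RestrictScalars k A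
    (((Tor (ModuleCat A) i).obj (ModuleCat.of A M)).obj (ModuleCat.of A N)))

/-- The `i`-th total Betti number `dim_k Tor_i(S/I, k)` of `S/I`, where
`k = S/(x_i : i ∈ σ)`. -/
noncomputable def bettiNum (k : Type) [Field k] {σ : Type} (I : Ideal (MvPolynomial σ k))
    (i : ℕ) : Cardinal :=
  torRank k (MvPolynomial σ k) (MvPolynomial σ k ⧸ I)
    (MvPolynomial σ k ⧸ irrelevantIdeal k σ) i

/-- The first map `I_S → I_C ⊕ I_S`, `g ↦ (g, f·g)`, of the basic double linkage sequence. -/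
def bdlFirstMap {A : Type*} [CommRing A] {I_S I_C : Ideal A} (h : I_S ≤ I_C) (f : A) :
    I_S →ₗ[A] I_C × I_S :=
  LinearMap.prod (Submodule.inclusion h) (f • LinearMap.id)

/-- The second map `I_C ⊕ I_S → f·I_C + I_S`, `(a, b) ↦ f·a - b`, of the basic double
linkage sequence. -/
def bdlSecondMap {A : Type*} [CommRing A] (I_C I_S : Ideal A) (f : A) :
    I_C × I_S →ₗ[A] ↥(Ideal.span {f} * I_C + I_S) :=
  LinearMap.coprod
    (LinearMap.codRestrict ((Ideal.span {f} * I_C + I_S : Ideal A) : Submodule A A)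
      (f • (Submodule.subtype (I_C : Submodule A A)))
      (fun c => Submodule.mem_sup_left
        (Ideal.mul_mem_mul (Ideal.mem_span_singleton_self f) c.2)))
    (- LinearMap.codRestrict ((Ideal.span {f} * I_C + I_S : Ideal A) : Submodule A A)
      (Submodule.subtype (I_S : Submodule A A))
      (fun c => Submodule.mem_sup_right c.2))

/-- The ideal `I_{V_{λ,c}}` of the codimension-`c` configuration determined by `f_1, …, f_s`:
the intersection of the ideals `(f_{i_1}, …, f_{i_c})` over all `c`-subsets. -/
def configIdeal {A : Type*} [CommRing A] {s : ℕ} (c : ℕ) (f : Fin s → A) : Ideal A :=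
  ⨅ T ∈ {T : Finset (Fin s) | T.card = c}, Ideal.span (f '' ↑T)

/-- Every sublist of at most `m` of the elements `f 1, …, f s` (in any order, without
repetitions) is a regular sequence. -/
def SubsetsRegular {A : Type*} [CommRing A] {s : ℕ} (f : Fin s → A) (m : ℕ) : Prop :=
  ∀ l : List (Fin s), l.Nodup → l.length ≤ m →
    RingTheory.Sequence.IsRegular A (l.map f)

/-- `Δ` is (the independence complex of) a matroid on `{1, …, s}`: a nonempty collection of
subsets closed under inclusion and satisfying the augmentation axiom. -/
def IsMatroid {s : ℕ} (Δ : Finset (Fin s) → Prop) : Prop :=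
  Δ ∅ ∧ (∀ F G : Finset (Fin s), Δ F → G ⊆ F → Δ G) ∧
    (∀ F G : Finset (Fin s), Δ F → Δ G → G.card < F.card →
      ∃ j ∈ F, j ∉ G ∧ Δ (insert j G))

/-- `F` is a basis (facet) of the simplicial complex `Δ`: a maximal face. -/
def IsBasisOf {s : ℕ} (Δ : Finset (Fin s) → Prop) (F : Finset (Fin s)) : Prop :=
  Δ F ∧ ∀ G : Finset (Fin s), Δ G → F ⊆ G → G = F

/-- The Stanley–Reisner ideal of `Δ`, generated by the squarefree monomials corresponding
to the non-faces of `Δ`. -/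
def stanleyReisnerIdeal (k : Type) [Field k] {s : ℕ} (Δ : Finset (Fin s) → Prop) :
    Ideal (MvPolynomial (Fin s) k) :=
  Ideal.span
    ((fun F : Finset (Fin s) => ∏ i ∈ F, (X i : MvPolynomial (Fin s) k)) '' {F | ¬ Δ F})

/-- The ideal `I_{W_c}`: the intersection of all ideals `(A_{i_1,j_1}, …, A_{i_c,j_c})`
where `i_1 < ⋯ < i_c` and each generator is chosen from a different group. -/
def multiPartiteIdeal {A : Type*} [CommRing A] {s : ℕ} (c : ℕ) {e : Fin s → ℕ}
    (g : (i : Fin s) → Fin (e i) → A) : Ideal A :=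
  ⨅ T ∈ {T : Finset (Fin s) | T.card = c}, ⨅ j : (i : Fin s) → Fin (e i),
    Ideal.span ((fun i => g i (j i)) '' ↑T)

end


section Koszul

variable {ι R : Type} [CommRing R]

/-- The first syzygies of `f i`, `i ∈ T`, are generated by the Koszul relations, expressed by
testing against modules. -/
def KoszulRelations (f : ι → R) (T : Finset ι) : Prop :=
  ∀ (N : Type) [AddCommGroup N] [Module R N] (v : ι → N),
    (∀ i ∈ T, ∀ j ∈ T, f i • v j = f j • v i) →
    ∀ q : ι → R, ∑ i ∈ T, q i * f i = 0 → ∑ i ∈ T, q i • v i = 0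

lemma koszulRelations_insert [DecidableEq ι] {f : ι → R} {T : Finset ι} {j : ι} (hj : j ∉ T)
    (hT : KoszulRelations f T)
    (hreg : ∀ r, f j * r ∈ Ideal.span (f '' T) → r ∈ Ideal.span (f '' T)) :
    KoszulRelations f (insert j T) := by
  intro N _ _ v hv q hq
  rw [Finset.sum_insert hj] at hq ⊢
  have hmem : q j ∈ Ideal.span (f '' T) := by
    apply hreg
    have : f j * q j = - ∑ i ∈ T, q i * f i := by linear_combination hq
    rw [this]
    exact neg_mem (sum_mem fun i hi => Ideal.mul_mem_left _ _
      (Ideal.subset_span ⟨i, hi, rfl⟩))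
  obtain ⟨z, hz⟩ := (Submodule.mem_span_image_finset_iff_exists_fun' R).1 hmem
  have hz' : ∑ i ∈ T, z i * f i = q j := by simpa using hz
  have key := hT N v (fun i hi l hl => hv i (Finset.mem_insert_of_mem hi) l
    (Finset.mem_insert_of_mem hl)) (fun i => q i + z i * f j) (by
      rw [← hq, ← hz', Finset.sum_mul, add_comm, ← Finset.sum_add_distrib]
      exact Finset.sum_congr rfl fun i _ => by ring)
  rw [← key, ← hz', Finset.sum_smul, add_comm, ← Finset.sum_add_distrib]
  refine Finset.sum_congr rfl fun i hi => ?_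
  rw [mul_smul, hv i (Finset.mem_insert_of_mem hi) j (Finset.mem_insert_self _ _), add_smul,
    mul_smul]

end Koszul

/-! ### Ideals generated by monomials in a family of ring elements -/

section Cells

variable {ι : Type} [DecidableEq ι] {g : ι → ℕ} {T : Finset ι}

lemma add_mem_cell {e : ι → ℕ} {j : ι} (hj : j ∉ T) (he : g ≤ e ∧ ∀ t ∈ T, e t = g t) :
    g ≤ e + Pi.single j 1 ∧ ∀ t ∈ T, (e + Pi.single j 1 : ι → ℕ) t = g t := by
  refine ⟨he.1.trans (by simp), fun t ht => ?_⟩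
  have : t ≠ j := fun h => hj (h ▸ ht)
  simp [this, he.2 t ht]

lemma add_single_sub {e : ι → ℕ} (j : ι) (he : g ≤ e) :
    e + Pi.single j 1 - g = (e - g) + Pi.single j 1 :=
  tsub_add_eq_add_tsub he |>.symm

end Cells

section Monomials

variable {ι R : Type} [Fintype ι] [CommRing R]

/-- The monomial `∏ i, f i ^ e i` in the family `f`. -/
def familyMonomial (f : ι → R) (e : ι → ℕ) : R := ∏ i, f i ^ e i

/-- The ideal generated by the monomials in the family `f` with exponents in `E`. -/
def familyMonomialIdeal (f : ι → R) (E : Set (ι → ℕ)) : Ideal R :=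
  Ideal.span (familyMonomial f '' E)

lemma familyMonomial_zero (f : ι → R) : familyMonomial f 0 = 1 := by
  simp [familyMonomial]

lemma familyMonomial_add (f : ι → R) (a b : ι → ℕ) :
    familyMonomial f (a + b) = familyMonomial f a * familyMonomial f b := by
  simp [familyMonomial, pow_add, Finset.prod_mul_distrib]

variable [DecidableEq ι]

lemma familyMonomial_single (f : ι → R) (j : ι) :
    familyMonomial f (Pi.single j 1) = f j := by
  rw [familyMonomial, Finset.prod_eq_single j] <;> simp +contextual

lemma exponent_induction {p : (ι → ℕ) → Prop} (zero : p 0)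
    (add_single : ∀ e j, p e → p (e + Pi.single j 1)) (e : ι → ℕ) : p e := by
  induction hn : ∑ i, e i generalizing e with
  | zero =>
    have : e = 0 := by
      funext i
      simpa using (Finset.sum_eq_zero_iff.1 hn) i (Finset.mem_univ i)
    exact this ▸ zero
  | succ n ih =>
    obtain ⟨j, -, hj⟩ := Finset.exists_ne_zero_of_sum_ne_zero
      (show ∑ i, e i ≠ 0 by rw [hn]; exact n.succ_ne_zero)
    have he : e = (e - Pi.single j 1) + Pi.single j 1 := by
      funext i
      by_cases hij : i = j
      · subst hij
        simp only [Pi.add_apply, Pi.sub_apply, Pi.single_eq_same]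
        lia
      · simp [hij]
    rw [he]
    apply add_single
    apply ih
    rw [he] at hn
    simp only [Pi.add_apply, Finset.sum_add_distrib, Finset.sum_pi_single', Finset.mem_univ,
      if_true] at hn
    lia

/-- `h` is compatible with multiplication by the members of `f` on the set `E` of exponents. -/
def CompatibleOn (f : ι → R) (E : Set (ι → ℕ)) {N : Type} [AddCommGroup N] [Module R N]
    (h : (ι → ℕ) → N) : Prop :=
  ∀ e ∈ E, ∀ j, h (e + Pi.single j 1) = f j • h e

lemma CompatibleOn.apply_add {f : ι → R} {E : Set (ι → ℕ)} {N : Type} [AddCommGroup N]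
    [Module R N] {h : (ι → ℕ) → N} (hh : CompatibleOn f E h)
    (hE : ∀ e ∈ E, ∀ j, e + Pi.single j 1 ∈ E) {e : ι → ℕ} (he : e ∈ E) (b : ι → ℕ) :
    e + b ∈ E ∧ h (e + b) = familyMonomial f b • h e := by
  induction b using exponent_induction with
  | zero => simp [he, familyMonomial_zero]
  | add_single b j ih =>
    rw [← add_assoc, hh _ ih.1, ih.2, familyMonomial_add, familyMonomial_single, smul_smul,
      mul_comm]
    exact ⟨hE _ ih.1 j, rfl⟩

/-- All linear relations among the monomials in `f` with exponents in `E` are generated by the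
obvious ones, expressed by testing against every compatible system of elements of a module. -/
def TrivialRelations (f : ι → R) (E : Set (ι → ℕ)) : Prop :=
  ∀ (N : Type) [AddCommGroup N] [Module R N] (h : (ι → ℕ) → N), CompatibleOn f E h →
    ∀ r ∈ Finsupp.supported R R E, Finsupp.linearCombination R (familyMonomial f) r = 0 →
      Finsupp.linearCombination R h r = 0

lemma trivialRelations_univ (f : ι → R) : TrivialRelations f Set.univ := by
  intro N _ _ h hh r _ hr
  have h0 : h = fun e => LinearMap.toSpanSingleton R N (h 0) (familyMonomial f e) := by
    funext e
    simpa using (hh.apply_add (by simp) (Set.mem_univ 0) e).2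
  have h1 := Finsupp.apply_linearCombination R (LinearMap.toSpanSingleton R N (h 0))
    (familyMonomial f) r
  rw [hr, map_zero] at h1
  rw [h0]
  exact h1.symm

/-- The upper set `E'` of exponents is obtained from `E` by removing the cell of all exponents
that are at least `g` and agree with `g` on `T`. -/
structure IsCellRemoval (E E' : Set (ι → ℕ)) (g : ι → ℕ) (T : Finset ι) : Prop where
  add_single_mem : ∀ e ∈ E', ∀ j, e + Pi.single j 1 ∈ E'
  mem_iff : ∀ e, e ∈ E ↔ e ∈ E' ∨ (g ≤ e ∧ ∀ t ∈ T, e t = g t)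
  notMem : ∀ e, g ≤ e → (∀ t ∈ T, e t = g t) → e ∉ E'
  corner_mem : ∀ t ∈ T, g + Pi.single t 1 ∈ E'

namespace IsCellRemoval

variable {f : ι → R} {E E' : Set (ι → ℕ)} {g : ι → ℕ} {T : Finset ι}

open Classical in
lemma trivialRelations (hc : IsCellRemoval E E' g T) (hK : KoszulRelations f T)
    (hE : TrivialRelations f E) : TrivialRelations f E' := by
  intro N _ _ h hh r hr hr0
  let w : ι → N × R := fun t => (-h (g + Pi.single t 1), f t)
  let K : Submodule R (N × R) := Submodule.span R (w '' T)
  let h' : (ι → ℕ) → (N × R) ⧸ K := fun e =>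
    if e ∈ E' then K.mkQ (h e, 0) else K.mkQ (0, familyMonomial f (e - g))
  have hcompat : CompatibleOn f E h' := by
    intro e he j
    rcases (hc.mem_iff e).1 he with he | he
    · simp only [h', if_pos he, if_pos (hc.add_single_mem e he j), hh e he j, ← map_smul,
        Prod.smul_mk, smul_zero]
    · have he' := hc.notMem e he.1 he.2
      by_cases hj : j ∈ T
      · have heq : e + Pi.single j 1 = (g + Pi.single j 1) + (e - g) := by
          rw [add_right_comm, add_tsub_cancel_of_le he.1]
        obtain ⟨hmem, hval⟩ := hh.apply_add hc.add_single_mem (hc.corner_mem j hj) (e - g)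
        simp only [h', if_neg he']
        rw [heq, if_pos hmem, hval, ← map_smul, ← sub_eq_zero, ← map_sub, Submodule.mkQ_apply,
          Submodule.Quotient.mk_eq_zero]
        have := K.smul_mem (-familyMonomial f (e - g)) (Submodule.subset_span ⟨j, hj, rfl⟩)
        convert this using 1
        ext <;> simp [w, mul_comm]
      · have hcell := add_mem_cell hj he
        have hn := hc.notMem _ hcell.1 hcell.2
        simp only [h', if_neg he', if_neg hn, ← map_smul, add_single_sub j he.1,
          familyMonomial_add, familyMonomial_single, Prod.smul_mk, smul_zero, smul_eq_mul,
          mul_comm]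
  have hr' : r ∈ Finsupp.supported R R E :=
    Finsupp.supported_mono (fun e he => (hc.mem_iff e).2 (Or.inl he)) hr
  have hzero := hE _ h' hcompat r hr' hr0
  have heval : Finsupp.linearCombination R h' r
      = K.mkQ (Finsupp.linearCombination R h r, 0) := by
    have h1 := Finsupp.apply_linearCombination R (K.mkQ ∘ₗ LinearMap.inl R N R) h r
    simp only [LinearMap.coe_comp, Function.comp_apply, LinearMap.inl_apply] at h1
    rw [h1, Finsupp.linearCombination_apply, Finsupp.linearCombination_apply]
    refine Finsupp.sum_congr fun e he => ?_
    have : e ∈ E' := hr he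
    simp [h', if_pos this]
  rw [heval, Submodule.mkQ_apply, Submodule.Quotient.mk_eq_zero] at hzero
  obtain ⟨q, hq⟩ := (Submodule.mem_span_image_finset_iff_exists_fun' R).1 hzero
  have hq1 := congrArg Prod.fst hq
  have hq2 := congrArg Prod.snd hq
  simp only [w, Prod.fst_sum, Prod.snd_sum, Prod.smul_mk, smul_neg, smul_eq_mul,
    Finset.sum_neg_distrib] at hq1 hq2
  rw [← hq1, neg_eq_zero]
  refine hK N (fun t => h (g + Pi.single t 1)) (fun i hi j hj => ?_) q hq2
  rw [← hh _ (hc.corner_mem j hj) i, ← hh _ (hc.corner_mem i hi) j, add_right_comm]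

lemma le (hc : IsCellRemoval E E' g T) : familyMonomialIdeal f E' ≤ familyMonomialIdeal f E :=
  Ideal.span_mono (Set.image_mono fun e he => (hc.mem_iff e).2 (Or.inl he))

open Classical in
lemma colon_eq (hc : IsCellRemoval E E' g T) (hE : TrivialRelations f E) :
    (familyMonomialIdeal f E').colon {familyMonomial f g} = Ideal.span (f '' T) := by
  apply le_antisymm
  · intro a ha
    rw [Submodule.mem_colon_singleton, familyMonomialIdeal, Ideal.span,
      Finsupp.mem_span_image_iff_linearCombination] at ha
    obtain ⟨l, hl, hla⟩ := ha
    let Q := R ⧸ Ideal.span (f '' T)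
    let h : (ι → ℕ) → Q := fun e =>
      if g ≤ e ∧ ∀ t ∈ T, e t = g t then
        Ideal.Quotient.mk _ (familyMonomial f (e - g)) else 0
    have hcompat : CompatibleOn f E h := by
      intro e he j
      rcases (hc.mem_iff e).1 he with he | he
      · have h1 : ¬ (g ≤ e ∧ ∀ t ∈ T, e t = g t) := fun h => hc.notMem e h.1 h.2 he
        have h2 : ¬ (g ≤ e + Pi.single j 1 ∧ ∀ t ∈ T, (e + Pi.single j 1 : ι → ℕ) t = g t) :=
          fun h => hc.notMem _ h.1 h.2 (hc.add_single_mem e he j)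
        simp only [h, if_neg h1, if_neg h2, smul_zero]
      · by_cases hj : j ∈ T
        · have h2 : ¬ (g ≤ e + Pi.single j 1 ∧
              ∀ t ∈ T, (e + Pi.single j 1 : ι → ℕ) t = g t) := by
            intro h
            have := h.2 j hj
            simp [he.2 j hj] at this
          simp only [h, if_neg h2, if_pos he]
          rw [Algebra.smul_def, Ideal.Quotient.algebraMap_eq, ← map_mul, eq_comm,
            Ideal.Quotient.eq_zero_iff_mem]
          exact Ideal.mul_mem_right _ _ (Ideal.subset_span ⟨j, hj, rfl⟩)
        · simp only [h, if_pos he, if_pos (add_mem_cell hj he), add_single_sub j he.1,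
            familyMonomial_add, familyMonomial_single]
          rw [Algebra.smul_def, Ideal.Quotient.algebraMap_eq, ← map_mul, mul_comm]
    have hgE : g ∈ E := (hc.mem_iff g).2 (Or.inr ⟨le_rfl, fun _ _ => rfl⟩)
    have key := hE Q h hcompat (Finsupp.single g a - l)
      (sub_mem (Finsupp.single_mem_supported R a hgE)
        (Finsupp.supported_mono (fun e he => (hc.mem_iff e).2 (Or.inl he)) hl))
      (by rw [map_sub, hla]; simp)
    have hl0 : Finsupp.linearCombination R h l = 0 := by
      rw [Finsupp.linearCombination_apply]
      refine Finset.sum_eq_zero fun e he => ?_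
      have h1 : ¬ (g ≤ e ∧ ∀ t ∈ T, e t = g t) := fun h => hc.notMem e h.1 h.2 (hl he)
      simp only [h, if_neg h1, smul_zero]
    rw [map_sub, hl0, sub_zero, Finsupp.linearCombination_single] at key
    have hg : g ≤ g ∧ ∀ t ∈ T, g t = g t := ⟨le_rfl, fun _ _ => rfl⟩
    simp only [h, if_pos hg, tsub_self, familyMonomial_zero] at key
    rw [Algebra.smul_def, Ideal.Quotient.algebraMap_eq, ← map_mul, mul_one,
      Ideal.Quotient.eq_zero_iff_mem] at key
    exact key
  · rw [Ideal.span_le]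
    rintro _ ⟨t, ht, rfl⟩
    rw [SetLike.mem_coe, Submodule.mem_colon_singleton]
    refine Ideal.subset_span ⟨_, hc.corner_mem t ht, ?_⟩
    rw [familyMonomial_add, familyMonomial_single, smul_eq_mul, mul_comm]

lemma sup_span_singleton (hc : IsCellRemoval E E' g T) :
    familyMonomialIdeal f E' ⊔ Ideal.span {familyMonomial f g} = familyMonomialIdeal f E := by
  apply le_antisymm
  · refine sup_le hc.le ((Ideal.span_singleton_le_iff_mem _).2 (Ideal.subset_span
      ⟨g, (hc.mem_iff g).2 (Or.inr ⟨le_rfl, fun _ _ => rfl⟩), rfl⟩))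
  · refine Ideal.span_le.2 ?_
    rintro _ ⟨e, he, rfl⟩
    rcases (hc.mem_iff e).1 he with he | he
    · exact Ideal.mem_sup_left (Ideal.subset_span ⟨e, he, rfl⟩)
    · rw [← add_tsub_cancel_of_le he.1, familyMonomial_add]
      exact Ideal.mem_sup_right (Ideal.mul_mem_right _ _ (Ideal.mem_span_singleton_self _))

end IsCellRemoval

end Monomials

/-! ### Removing cells one at a time -/

section Faces

variable {ι : Type} {w : ι → ℕ → ℕ}

/-- The weights `w i (e i)` with `i ∈ T` are smaller than those with `i ∉ T`. -/
def IsLightFace (w : ι → ℕ → ℕ) (T : Finset ι) (e : ι → ℕ) : Prop :=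
  ∀ t ∈ T, ∀ j ∉ T, w t (e t) < w j (e j)

/-- The total weight of `e` on `T`. -/
def faceWeight (w : ι → ℕ → ℕ) (T : Finset ι) (e : ι → ℕ) : ℕ := ∑ t ∈ T, w t (e t)

lemma IsLightFace.unique {T T' : Finset ι} {e : ι → ℕ} (h : IsLightFace w T e)
    (h' : IsLightFace w T' e) (hcard : T.card = T'.card) : T = T' := by
  by_contra hne
  obtain ⟨t, ht, ht'⟩ : ∃ t ∈ T, t ∉ T' := by
    by_contra! hsub
    exact hne (Finset.eq_of_subset_of_card_le hsub hcard.ge)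
  obtain ⟨j, hj', hj⟩ : ∃ j ∈ T', j ∉ T := by
    by_contra! hsub
    exact hne (Finset.eq_of_subset_of_card_le hsub hcard.le).symm
  exact lt_asymm (h t ht j hj) (h' j hj' t ht')

lemma exists_minimal_face [Fintype ι] (w : ι → ℕ → ℕ) {c : ℕ} (hc : c ≤ Fintype.card ι) (e : ι → ℕ) :
    ∃ T : Finset ι, T.card = c ∧
      ∀ T' : Finset ι, T'.card = c → faceWeight w T e ≤ faceWeight w T' e := by
  obtain ⟨T, hT, hmin⟩ := Finset.exists_min_image (Finset.powersetCard c Finset.univ)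
    (fun T => faceWeight w T e) (Finset.powersetCard_nonempty.2 (by simpa using hc))
  simp only [Finset.mem_powersetCard_univ] at hT hmin
  exact ⟨T, hT, hmin⟩

variable [DecidableEq ι]

lemma isLightFace_of_minimal (hinj : ∀ i j u v, w i u = w j v → i = j) {T : Finset ι}
    {e : ι → ℕ}
    (hT : ∀ T' : Finset ι, T'.card = T.card → faceWeight w T e ≤ faceWeight w T' e) :
    IsLightFace w T e := by
  intro t ht j hj
  have hj' : j ∉ T.erase t := fun h => hj (Finset.mem_of_mem_erase h)
  have hle := hT (insert j (T.erase t)) (by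
    rw [Finset.card_insert_of_notMem hj', Finset.card_erase_add_one ht])
  rw [faceWeight, faceWeight, Finset.sum_insert hj', ← Finset.add_sum_erase T _ ht] at hle
  have hne : w t (e t) ≠ w j (e j) := fun h => hj (hinj _ _ _ _ h ▸ ht)
  lia

lemma IsLightFace.add_single (hmono : ∀ i, StrictMono (w i)) {T : Finset ι} {e : ι → ℕ} {j : ι}
    (h : IsLightFace w T e) (hj : j ∉ T) : IsLightFace w T (e + Pi.single j 1) := by
  intro t ht l hl
  have htj : t ≠ j := fun h => hj (h ▸ ht)
  have h1 : (e + Pi.single j 1 : ι → ℕ) t = e t := by simp [htj]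
  rw [h1]
  exact (h t ht l hl).trans_le ((hmono l).monotone (by simp))

/-- The exponents for which `T` is light and which agree with a given one on `T` are those that
are at least `g` and agree with `g` on `T`. -/
lemma exists_corner (hmono : ∀ i, StrictMono (w i)) (T : Finset ι) (x : ι → ℕ) :
    ∃ g : ι → ℕ, ∀ e, (IsLightFace w T e ∧ ∀ t ∈ T, e t = x t) ↔
      (g ≤ e ∧ ∀ t ∈ T, e t = g t) := by
  have hex : ∀ j, ∃ v, ∀ t ∈ T, w t (x t) < w j v := fun j =>
    ⟨faceWeight w T x + 1, fun t ht =>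
      (Finset.single_le_sum (f := fun t => w t (x t)) (fun _ _ => Nat.zero_le _) ht).trans_lt
        ((Nat.lt_succ_self _).trans_le ((hmono j).le_apply))⟩
  refine ⟨fun j => if j ∈ T then x j else Nat.find (hex j), fun e => ⟨?_, ?_⟩⟩
  · rintro ⟨hl, he⟩
    refine ⟨fun j => ?_, fun t ht => by simp [ht, he t ht]⟩
    by_cases hj : j ∈ T
    · simp [hj, he j hj]
    · simp only [if_neg hj]
      exact Nat.find_min' (hex j) fun t ht => he t ht ▸ hl t ht j hj
  · rintro ⟨hge, he⟩
    have he' : ∀ t ∈ T, e t = x t := fun t ht => by simpa [ht] using he t ht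
    refine ⟨fun t ht j hj => ?_, he'⟩
    have hgj := hge j
    simp only [if_neg hj] at hgj
    rw [he' t ht]
    exact (Nat.find_spec (hex j) t ht).trans_le ((hmono j).monotone hgj)

variable [Fintype ι]

lemma IsLightFace.faceWeight_le (hinj : ∀ i j u v, w i u = w j v → i = j) {T T' : Finset ι}
    {e : ι → ℕ} (h : IsLightFace w T e) (hcard : T'.card = T.card) :
    faceWeight w T e ≤ faceWeight w T' e := by
  obtain ⟨S, hS, hmin⟩ := exists_minimal_face w (Finset.card_le_univ T) e
  rw [h.unique (isLightFace_of_minimal hinj (hS.symm ▸ hmin)) hS.symm]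
  exact hmin T' hcard

lemma IsLightFace.faceWeight_lt (hinj : ∀ i j u v, w i u = w j v → i = j) {T T' : Finset ι}
    {e : ι → ℕ} (h : IsLightFace w T e) (hcard : T'.card = T.card) (hne : T' ≠ T) :
    faceWeight w T e < faceWeight w T' e := by
  refine lt_of_le_of_ne (h.faceWeight_le hinj hcard) fun heq => hne ?_
  refine (isLightFace_of_minimal hinj fun S hS => ?_).unique h hcard
  rw [← heq]
  exact h.faceWeight_le hinj (hS.trans hcard)

lemma IsLightFace.faceWeight_lt_add_single (hmono : ∀ i, StrictMono (w i))
    (hinj : ∀ i j u v, w i u = w j v → i = j) {T T' : Finset ι} {e : ι → ℕ} {t : ι}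
    (h : IsLightFace w T e) (hcard : T'.card = T.card) (ht : t ∈ T) :
    faceWeight w T e < faceWeight w T' (e + Pi.single t 1) := by
  have hle : faceWeight w T' e ≤ faceWeight w T' (e + Pi.single t 1) :=
    Finset.sum_le_sum fun i _ => (hmono i).monotone (by simp)
  by_cases heq : T' = T
  · subst heq
    refine Finset.sum_lt_sum (fun i _ => (hmono i).monotone (by simp)) ⟨t, ht, hmono t ?_⟩
    simp
  · exact (h.faceWeight_lt hinj hcard heq).trans_le hle

end Faces

section Filtration

variable {ι : Type} {w : ι → ℕ → ℕ} {τ : (ι → ℕ) → Finset ι}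

/-- Two exponents lie in the same cell: they have the same light face and agree on it. -/
def SameCell (τ : (ι → ℕ) → Finset ι) (x e : ι → ℕ) : Prop :=
  τ e = τ x ∧ ∀ t ∈ τ x, e t = x t

lemma SameCell.faceWeight_eq {x e : ι → ℕ} (h : SameCell τ x e) :
    faceWeight w (τ e) e = faceWeight w (τ x) x := by
  rw [h.1]
  exact Finset.sum_congr rfl fun t ht => by rw [h.2 t ht]

variable {R : Type} [Fintype ι] [DecidableEq ι] [CommRing R] {f : ι → R} {c : ℕ}

lemma filtration_induction_of_weights (hmono : ∀ i, StrictMono (w i))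
    (hinj : ∀ i j u v, w i u = w j v → i = j)
    (hτc : ∀ e, (τ e).card = c) (hτ : ∀ e, IsLightFace w (τ e) e)
    (hK : ∀ T : Finset ι, T.card = c → KoszulRelations f T) {motive : Ideal R → Prop}
    (top : motive ⊤)
    (step : ∀ (I : Ideal R) (a : R) (T : Finset ι), T.card = c →
      I.colon {a} = Ideal.span (f '' T) → motive (I ⊔ Ideal.span {a}) → motive I)
    (B : Finset (ι → ℕ))
    (hB : ∀ x ∈ B, ∀ e, faceWeight w (τ e) e < faceWeight w (τ x) x → ∃ b ∈ B, SameCell τ b e) :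
    TrivialRelations f {e | ∀ b ∈ B, ¬ SameCell τ b e} ∧
      motive (familyMonomialIdeal f {e | ∀ b ∈ B, ¬ SameCell τ b e}) := by
  have hsame : ∀ x e, SameCell τ x e ↔ IsLightFace w (τ x) e ∧ ∀ t ∈ τ x, e t = x t :=
    fun x e => and_congr_left fun _ => ⟨fun h => h ▸ hτ e, fun h =>
      (hτ e).unique h ((hτc e).trans (hτc x).symm)⟩
  induction B using Finset.induction_on_max_value (fun x => faceWeight w (τ x) x) with
  | empty =>
    have h1 : {e : ι → ℕ | ∀ b ∈ (∅ : Finset (ι → ℕ)), ¬ SameCell τ b e} = Set.univ := by simp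
    rw [h1]
    refine ⟨trivialRelations_univ f, ?_⟩
    convert top
    exact Ideal.eq_top_of_isUnit_mem _ (Ideal.subset_span ⟨0, Set.mem_univ _, rfl⟩)
      (by simp [familyMonomial_zero])
  | insert x B hx hmax ih =>
    by_cases hdup : ∃ b ∈ B, SameCell τ b x
    · obtain ⟨b, hb, hbx⟩ := hdup
      have htrans : ∀ e, SameCell τ x e → SameCell τ b e := fun e h =>
        ⟨h.1.trans hbx.1, fun t ht => (h.2 t (hbx.1 ▸ ht)).trans (hbx.2 t ht)⟩
      have hset : {e | ∀ b ∈ insert x B, ¬ SameCell τ b e} = {e | ∀ b ∈ B, ¬ SameCell τ b e} := by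
        ext e
        simp only [Finset.mem_insert, forall_eq_or_imp, Set.mem_ofPred_eq, and_iff_right_iff_imp]
        exact fun h hxe => h b hb (htrans e hxe)
      rw [hset]
      refine ih fun y hy e he => ?_
      obtain ⟨a, ha, hae⟩ := hB y (Finset.mem_insert_of_mem hy) e he
      rcases Finset.mem_insert.1 ha with rfl | ha
      · exact ⟨b, hb, htrans e hae⟩
      · exact ⟨a, ha, hae⟩
    · push Not at hdup
      obtain ⟨ihT, ihP⟩ := ih fun y hy e he => by
        obtain ⟨a, ha, hae⟩ := hB y (Finset.mem_insert_of_mem hy) e he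
        rcases Finset.mem_insert.1 ha with rfl | ha
        · exact absurd (hae.faceWeight_eq (w := w)) (he.trans_le (hmax y hy)).ne
        · exact ⟨a, ha, hae⟩
      obtain ⟨g, hg⟩ := exists_corner hmono (τ x) x
      have hcell : ∀ e, SameCell τ x e ↔ g ≤ e ∧ ∀ t ∈ τ x, e t = g t := fun e =>
        (hsame x e).trans (hg e)
      have hgx : SameCell τ x g := (hcell g).2 ⟨le_rfl, fun _ _ => rfl⟩
      have hrem : IsCellRemoval {e | ∀ b ∈ B, ¬ SameCell τ b e}
          {e | ∀ b ∈ insert x B, ¬ SameCell τ b e} g (τ x) := by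
        refine ⟨fun e he j b hb hbe => ?_, fun e => ?_, fun e h1 h2 he => ?_,
          fun t ht b hb hbe => ?_⟩
        · by_cases hj : j ∈ τ e
          · obtain ⟨b', hb', hbe'⟩ := hB b hb e (by
              rw [← hbe.faceWeight_eq (w := w)]
              exact (hτ e).faceWeight_lt_add_single hmono hinj
                ((hτc _).trans (hτc e).symm) hj)
            exact he b' hb' hbe'
          · have hτe : τ (e + Pi.single j 1) = τ e :=
              (hτ _).unique ((hτ e).add_single hmono hj) ((hτc _).trans (hτc e).symm)
            refine he b hb ⟨hτe ▸ hbe.1, fun t ht => ?_⟩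
            rw [← hbe.2 t ht]
            have : t ≠ j := by
              rintro rfl
              rw [← hbe.1, hτe] at ht
              exact hj ht
            simp [this]
        · rw [← hcell e]
          simp only [Finset.mem_insert, forall_eq_or_imp, Set.mem_ofPred_eq]
          refine ⟨fun h => ?_, ?_⟩
          · by_cases hxe : SameCell τ x e
            · exact Or.inr hxe
            · exact Or.inl ⟨hxe, h⟩
          · rintro (h | hxe) b hb hbe
            · exact h.2 b hb hbe
            · have hxb : τ x = τ b := hxe.1.symm.trans hbe.1
              exact hdup b hb ⟨hxb, fun t ht => (hxe.2 t (hxb ▸ ht)).symm.trans (hbe.2 t ht)⟩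
        · exact he x (Finset.mem_insert_self _ _) ((hcell e).2 ⟨h1, h2⟩)
        · have h1 := hbe.faceWeight_eq (w := w)
          have h2 : faceWeight w (τ b) b ≤ faceWeight w (τ x) x := by
            rcases Finset.mem_insert.1 hb with rfl | hb
            · exact le_rfl
            · exact hmax b hb
          have h3 := (hτ g).faceWeight_lt_add_single hmono hinj
            ((hτc (g + Pi.single t 1)).trans (hτc g).symm) (hgx.1 ▸ ht)
          rw [hgx.faceWeight_eq] at h3
          exact absurd h3 (h1.trans_le h2).not_gt
      refine ⟨hrem.trivialRelations (hK _ (hτc x)) ihT, ?_⟩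
      refine step _ (familyMonomial f g) (τ x) (hτc x) (hrem.colon_eq ihT) ?_
      rw [hrem.sup_span_singleton]
      exact ihP

end Filtration

section Power

/-- The exponents `e` for which the monomial belongs to the `m`-th power of `(x_t : t ∈ T)` for
all `T` of cardinality `c`. -/
def symbolicExponents (s c m : ℕ) : Set (Fin s → ℕ) :=
  {e | ∀ T : Finset (Fin s), T.card = c → m ≤ ∑ t ∈ T, e t}

lemma filtration_induction {R : Type} [CommRing R] {s c m : ℕ} (hcs : c ≤ s) {f : Fin s → R}
    (hK : ∀ T : Finset (Fin s), T.card = c → KoszulRelations f T) {motive : Ideal R → Prop}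
    (top : motive ⊤)
    (step : ∀ (I : Ideal R) (a : R) (T : Finset (Fin s)), T.card = c →
      I.colon {a} = Ideal.span (f '' T) → motive (I ⊔ Ideal.span {a}) → motive I) :
    motive (familyMonomialIdeal f (symbolicExponents s c m)) := by
  have hss : s ≤ c * s + s + 1 := by lia
  obtain ⟨N, hN⟩ : ∃ N, N = c * s + s + 1 := ⟨_, rfl⟩
  let w : Fin s → ℕ → ℕ := fun i v => N * v + i
  have hmono : ∀ i, StrictMono (w i) := fun i u v huv => by
    have : N * u < N * v := Nat.mul_lt_mul_of_pos_left huv (by lia)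
    simpa [w] using this
  have hinj : ∀ i j u v, w i u = w j v → i = j := fun i j u v h => by
    have h1 := congrArg (· % N) h
    simp only [w, Nat.mul_add_mod] at h1
    rwa [Nat.mod_eq_of_lt (by lia), Nat.mod_eq_of_lt (by lia), Fin.val_inj] at h1
  have hex : ∀ e, ∃ T : Finset (Fin s), T.card = c ∧ IsLightFace w T e := fun e => by
    obtain ⟨T, hT, hmin⟩ := exists_minimal_face w (by simpa using hcs) e
    exact ⟨T, hT, isLightFace_of_minimal hinj (hT.symm ▸ hmin)⟩
  choose τ hτc hτ using hex
  have hle : ∀ (T : Finset (Fin s)) e, N * ∑ t ∈ T, e t ≤ faceWeight w T e := fun T e => by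
    rw [Finset.mul_sum]
    exact Finset.sum_le_sum fun t _ => by simp [w]
  have hlt : ∀ (T : Finset (Fin s)) e, T.card = c →
      faceWeight w T e < N * (∑ t ∈ T, e t + 1) := fun T e hT => by
    have h1 : ∑ t ∈ T, (t : ℕ) ≤ c * s := by
      rw [← hT, ← smul_eq_mul]
      exact Finset.sum_le_card_nsmul _ _ _ fun t _ => t.2.le
    simp only [faceWeight, w, Finset.sum_add_distrib, ← Finset.mul_sum, mul_add]
    lia
  have hlight : ∀ e (t : Fin s), t ∈ τ e → w t (e t) ≤ faceWeight w (τ e) e := fun e t ht =>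
    Finset.single_le_sum (f := fun t => w t (e t)) (fun _ _ => Nat.zero_le _) ht
  have hrep : ∀ e, faceWeight w (τ e) e < N * m → SameCell τ (fun i => min (e i) m) e := by
    intro e he
    have hbd : ∀ t ∈ τ e, min (e t) m = e t := fun t ht => by
      have h1 := (hlight e t ht).trans_lt he
      have h2 : N * e t < N * m := lt_of_le_of_lt (by simp [w]) h1
      exact min_eq_left (lt_of_mul_lt_mul_left h2 (Nat.zero_le _)).le
    have hface : τ (fun i => min (e i) m) = τ e := by
      refine (hτ _).unique (fun t ht j hj => ?_) ((hτc _).trans (hτc e).symm)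
      rw [hbd t ht]
      rcases min_choice (e j) m with h | h <;> rw [h]
      · exact hτ e t ht j hj
      · exact ((hlight e t ht).trans_lt he).trans_le (by simp [w])
    refine ⟨hface.symm, fun t ht => (hbd t (hface ▸ ht)).symm⟩
  let A : Finset (Fin s → ℕ) := {e ∈ Finset.Iic (fun _ => m) | faceWeight w (τ e) e < N * m}
  have hA : ∀ e, faceWeight w (τ e) e < N * m → ∃ b ∈ A, SameCell τ b e := fun e he =>
    ⟨_, Finset.mem_filter.2 ⟨Finset.mem_Iic.2 fun i => min_le_right _ _,
      (hrep e he).faceWeight_eq (w := w) ▸ he⟩, hrep e he⟩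
  have hset : {e | ∀ b ∈ A, ¬ SameCell τ b e} = symbolicExponents s c m := by
    ext e
    refine ⟨fun h T hT => ?_, fun h b hb hbe => ?_⟩
    · by_contra! hcon
      obtain ⟨b, hb, hbe⟩ := hA e (((hτ e).faceWeight_le hinj (hT.trans (hτc e).symm)).trans_lt
        ((hlt T e hT).trans_le (Nat.mul_le_mul_left N hcon)))
      exact h b hb hbe
    · have h1 := (Finset.mem_filter.1 hb).2
      rw [← hbe.faceWeight_eq (w := w)] at h1
      exact absurd (lt_of_mul_lt_mul_left ((hle _ _).trans_lt h1) (Nat.zero_le _))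
        (h _ (hτc e)).not_gt
  rw [← hset]
  exact (filtration_induction_of_weights hmono hinj hτc hτ hK top step A fun x hx e he =>
    hA e (he.trans (Finset.mem_filter.1 hx).2)).2

end Power

/-! ### Associated primes and symbolic powers -/

section Colon

variable {R : Type} [CommRing R]

/-- Multiplication by `a` as a map `R ⧸ (I : a) → R ⧸ I`. -/
def colonQuotientMul (I : Ideal R) (a : R) : (R ⧸ I.colon {a}) →ₗ[R] R ⧸ I :=
  Submodule.mapQ _ _ (LinearMap.mulLeft R a) fun r hr => by
    simpa [Submodule.mem_colon_singleton, mul_comm] using hr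

lemma colonQuotientMul_injective (I : Ideal R) (a : R) :
    Function.Injective (colonQuotientMul I a) := by
  rw [injective_iff_map_eq_zero]
  intro x hx
  obtain ⟨r, rfl⟩ := Submodule.Quotient.mk_surjective _ x
  rw [colonQuotientMul, Submodule.mapQ_apply, Submodule.Quotient.mk_eq_zero] at hx
  rw [Submodule.Quotient.mk_eq_zero, Submodule.mem_colon_singleton]
  simpa [mul_comm] using hx

lemma colonQuotientMul_exact (I : Ideal R) (a : R) :
    Function.Exact (colonQuotientMul I a)
      (Submodule.factor (le_sup_left : I ≤ I ⊔ Ideal.span {a})) := by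
  intro x
  obtain ⟨r, rfl⟩ := Submodule.Quotient.mk_surjective _ x
  have hmem : Submodule.factor (le_sup_left : I ≤ I ⊔ Ideal.span {a}) (Submodule.Quotient.mk r) = 0
      ↔ r ∈ I ⊔ Ideal.span {a} := Submodule.Quotient.mk_eq_zero _
  rw [hmem, sup_comm, Ideal.mem_span_singleton_sup]
  constructor
  · rintro ⟨b, i, hi, rfl⟩
    refine ⟨Submodule.Quotient.mk b, ?_⟩
    rw [colonQuotientMul, Submodule.mapQ_apply, Submodule.Quotient.eq]
    simpa [mul_comm] using hi
  · rintro ⟨y, hy⟩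
    obtain ⟨b, rfl⟩ := Submodule.Quotient.mk_surjective _ y
    rw [colonQuotientMul, Submodule.mapQ_apply, Submodule.Quotient.eq] at hy
    exact ⟨b, r - a * b, by simpa using neg_mem hy, by ring⟩

lemma isAssociatedPrime_quotient_iff [IsNoetherianRing R] {P I : Ideal R} :
    IsAssociatedPrime P (R ⧸ I) ↔ P.IsPrime ∧ ∃ y, ∀ r, r ∈ P ↔ r * y ∈ I := by
  rw [isAssociatedPrime_iff]
  refine and_congr_right fun _ => ⟨?_, ?_⟩
  · rintro ⟨x, rfl⟩
    obtain ⟨y, rfl⟩ := Submodule.Quotient.mk_surjective _ x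
    refine ⟨y, fun r => ?_⟩
    rw [Submodule.mem_colon_singleton, ← Submodule.Quotient.mk_smul, Submodule.mem_bot,
      Submodule.Quotient.mk_eq_zero, smul_eq_mul]
  · rintro ⟨y, hy⟩
    refine ⟨Submodule.Quotient.mk y, Ideal.ext fun r => ?_⟩
    rw [Submodule.mem_colon_singleton, ← Submodule.Quotient.mk_smul, Submodule.mem_bot,
      Submodule.Quotient.mk_eq_zero, smul_eq_mul, hy]

lemma exists_isAssociatedPrime_of_notMem [IsNoetherianRing R] {I : Ideal R} {x : R}
    (hx : x ∉ I) :
    ∃ P : Ideal R, IsAssociatedPrime P (R ⧸ I) ∧ ∀ r, r * x ∈ I → r ∈ P := by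
  obtain ⟨P, hP, hle⟩ := exists_le_isAssociatedPrime_of_isNoetherianRing R
    (Submodule.Quotient.mk x : R ⧸ I) (by rwa [Ne, Submodule.Quotient.mk_eq_zero])
  refine ⟨P, hP, fun r hr => hle ?_⟩
  rwa [Submodule.mem_colon_singleton, ← Submodule.Quotient.mk_smul, Submodule.mem_bot,
    Submodule.Quotient.mk_eq_zero]

lemma mem_comap_map_primeCompl_iff {P : Ideal R} [P.IsPrime] {I : Ideal R} {x : R} :
    x ∈ (I.map (algebraMap R (Localization P.primeCompl))).comap
      (algebraMap R (Localization P.primeCompl)) ↔ ∃ r ∉ P, r * x ∈ I := by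
  rw [Ideal.mem_comap, IsLocalization.mem_map_algebraMap_iff P.primeCompl]
  constructor
  · rintro ⟨⟨a, b⟩, hab⟩
    rw [← map_mul] at hab
    obtain ⟨r, hr⟩ := (IsLocalization.eq_iff_exists P.primeCompl _).1 hab
    refine ⟨r * b, (r * b).2, ?_⟩
    have : (r * b : R) * x = r * a := by linear_combination hr
    rw [this]
    exact Ideal.mul_mem_left _ _ a.2
  · rintro ⟨r, hr, hrx⟩
    exact ⟨⟨⟨r * x, hrx⟩, ⟨r, hr⟩⟩, by rw [← map_mul, mul_comm]⟩

lemma mem_symbolicPower_iff {J : Ideal R} {m : ℕ} {x : R} :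
    x ∈ symbolicPower J m ↔ ∀ P : Ideal R, IsAssociatedPrime P (R ⧸ J) → ∃ r ∉ P, r * x ∈ J ^ m := by
  rw [symbolicPower, Submodule.mem_sInf]
  constructor
  · intro h P hP
    have := hP.1
    exact mem_comap_map_primeCompl_iff.1 (h _ ⟨P, hP, rfl⟩)
  · rintro h _ ⟨P, hP, rfl⟩
    have := hP.1
    exact mem_comap_map_primeCompl_iff.2 (h P hP)

end Colon

section Symbolic

variable {R : Type} [CommRing R] {s c : ℕ} {f : Fin s → R}

/-- Every member of `f` outside a subset `T` of cardinality at most `c` is a non-zero-divisor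
modulo the ideal generated by the members in `T`. -/
def RegularModSubsets (f : Fin s → R) (c : ℕ) : Prop :=
  ∀ T : Finset (Fin s), T.card ≤ c → ∀ j ∉ T, ∀ r,
    f j * r ∈ Ideal.span (f '' T) → r ∈ Ideal.span (f '' T)

lemma SubsetsRegular.regularModSubsets (h : SubsetsRegular f (c + 1)) :
    RegularModSubsets f c := by
  intro T hT j hj r hr
  have hreg := (h (T.toList ++ [j]) (by
    simpa [List.nodup_append, T.nodup_toList] using hj)
    (by simpa using hT)).toIsWeaklyRegular
  rw [List.map_append, RingTheory.Sequence.isWeaklyRegular_append_iff, List.map_singleton,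
    RingTheory.Sequence.isWeaklyRegular_singleton_iff] at hreg
  have hspan : (Ideal.ofList (T.toList.map f) • ⊤ : Submodule R R) = Ideal.span (f '' T) := by
    rw [smul_eq_mul, Ideal.mul_top, Ideal.ofList]
    congr 1
    ext x
    simp
  rw [← hspan] at hr ⊢
  rw [← Submodule.Quotient.mk_eq_zero]
  refine hreg.2.right_eq_zero_of_smul ?_
  rw [← Submodule.Quotient.mk_smul, Submodule.Quotient.mk_eq_zero]
  exact hr

lemma RegularModSubsets.koszulRelations (h : RegularModSubsets f c) (T : Finset (Fin s))
    (hT : T.card ≤ c + 1) : KoszulRelations f T := by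
  induction T using Finset.induction_on with
  | empty => intro N _ _ v _ q _; simp
  | insert j T hj ih =>
    rw [Finset.card_insert_of_notMem hj] at hT
    exact koszulRelations_insert hj (ih (by lia)) (h T (by lia) j hj)

/-- The ideal generated by the monomials in `f` lying formally in the `m`-th power of
`(f t : t ∈ T)` for all `T` of cardinality `c`. -/
def symbolicMonomialIdeal (f : Fin s → R) (c m : ℕ) : Ideal R :=
  familyMonomialIdeal f (symbolicExponents s c m)

lemma familyMonomial_mem_span_pow (f : Fin s → R) (e : Fin s → ℕ) (T : Finset (Fin s)) :
    familyMonomial f e ∈ Ideal.span (f '' T) ^ ∑ t ∈ T, e t := by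
  rw [familyMonomial, ← Finset.prod_mul_prod_compl T]
  refine Ideal.mul_mem_right _ _ ?_
  rw [← Finset.prod_pow_eq_pow_sum]
  refine Ideal.prod_mem_prod fun t ht => ?_
  exact Ideal.pow_mem_pow (Ideal.subset_span (Set.mem_image_of_mem f ht)) _

lemma symbolicMonomialIdeal_le_pow (f : Fin s → R) {m : ℕ} {T : Finset (Fin s)}
    (hT : T.card = c) : symbolicMonomialIdeal f c m ≤ Ideal.span (f '' T) ^ m := by
  refine Ideal.span_le.2 ?_
  rintro _ ⟨e, he, rfl⟩
  exact Ideal.pow_le_pow_right (he T hT) (familyMonomial_mem_span_pow f e T)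

lemma symbolicMonomialIdeal_mul_le (f : Fin s → R) (c a b : ℕ) :
    symbolicMonomialIdeal f c a * symbolicMonomialIdeal f c b
      ≤ symbolicMonomialIdeal f c (a + b) := by
  rw [symbolicMonomialIdeal, familyMonomialIdeal, symbolicMonomialIdeal, familyMonomialIdeal,
    Ideal.span_mul_span', Ideal.span_le]
  rintro _ ⟨_, ⟨d, hd, rfl⟩, _, ⟨e, he, rfl⟩, rfl⟩
  refine Ideal.subset_span ⟨d + e, fun T hT => ?_, familyMonomial_add f d e⟩
  simp only [Pi.add_apply, Finset.sum_add_distrib]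
  exact add_le_add (hd T hT) (he T hT)

lemma symbolicMonomialIdeal_one_pow_le (f : Fin s → R) (c m : ℕ) :
    symbolicMonomialIdeal f c 1 ^ m ≤ symbolicMonomialIdeal f c m := by
  induction m with
  | zero =>
    have : (1 : R) ∈ symbolicMonomialIdeal f c 0 :=
      Ideal.subset_span ⟨0, fun _ _ => Nat.zero_le _, familyMonomial_zero f⟩
    rw [(Ideal.eq_top_iff_one _).2 this]
    exact le_top
  | succ m ih =>
    rw [pow_succ]
    exact (Ideal.mul_mono_left ih).trans (symbolicMonomialIdeal_mul_le f c m 1)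

lemma span_mul_prod_compl_le (f : Fin s → R) {T : Finset (Fin s)} (hT : T.card = c) :
    Ideal.span (f '' T) * Ideal.span {∏ j ∈ Tᶜ, f j} ≤ symbolicMonomialIdeal f c 1 := by
  rw [Ideal.span_mul_span', Ideal.span_le]
  rintro _ ⟨_, ⟨t, ht, rfl⟩, _, rfl, rfl⟩
  have ht' : t ∉ Tᶜ := by simpa using ht
  refine Ideal.subset_span ⟨fun i => if i ∈ insert t Tᶜ then 1 else 0, fun S hS => ?_, ?_⟩
  · obtain ⟨i, hi, hiT⟩ : ∃ i ∈ S, i ∈ insert t Tᶜ := by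
      by_contra! hcon
      have hsub : S ⊆ T.erase t := fun i hi => by
        have := hcon i hi
        simp only [Finset.mem_insert, Finset.mem_compl, not_or, not_not] at this
        exact Finset.mem_erase.2 this
      have := Finset.card_le_card hsub
      rw [hS, Finset.card_erase_of_mem ht, hT] at this
      have := Finset.card_pos.2 ⟨t, ht⟩
      lia
    exact le_trans (by simp only [if_pos hiT, le_refl]) (Finset.single_le_sum
      (f := fun i => if i ∈ insert t Tᶜ then 1 else 0) (fun _ _ => Nat.zero_le _) hi)
  · simp only [familyMonomial, pow_ite, pow_one, pow_zero, Finset.prod_ite_mem,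
      Finset.univ_inter, Finset.prod_insert ht']

lemma prod_compl_pow_mul_mem (f : Fin s → R) {m : ℕ} {T : Finset (Fin s)} (hT : T.card = c)
    {x : R} (hx : x ∈ Ideal.span (f '' T) ^ m) :
    (∏ j ∈ Tᶜ, f j) ^ m * x ∈ symbolicMonomialIdeal f c 1 ^ m := by
  refine Ideal.pow_right_mono (span_mul_prod_compl_le f hT) m ?_
  rw [mul_pow, mul_comm (_ ^ m) x]
  exact Ideal.mul_mem_mul hx (Ideal.pow_mem_pow (Ideal.mem_span_singleton_self _) _)

lemma symbolicMonomialIdeal_eq_span_finsupp_prod (f : Fin s → R)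
    (c m : ℕ) : symbolicMonomialIdeal f c m = Ideal.span
      ((fun e : Fin s →₀ ℕ => e.prod fun i t => f i ^ t) '' {e | ⇑e ∈ symbolicExponents s c m}) := by
  rw [symbolicMonomialIdeal, familyMonomialIdeal]
  congr 1
  ext x
  constructor
  · rintro ⟨e, he, rfl⟩
    exact ⟨Finsupp.equivFunOnFinite.symm e, he, Finsupp.prod_fintype _ _ fun _ => pow_zero _⟩
  · rintro ⟨e, he, rfl⟩
    exact ⟨e, he, (Finsupp.prod_fintype _ _ fun _ => pow_zero _).symm⟩

lemma RegularModSubsets.exists_isAssociatedPrime (h : RegularModSubsets f c) (hcs : c ≤ s)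
    {m : ℕ} {P : Ideal R} (hP : IsAssociatedPrime P (R ⧸ symbolicMonomialIdeal f c m)) :
    ∃ T : Finset (Fin s), T.card = c ∧ IsAssociatedPrime P (R ⧸ Ideal.span (f '' T)) := by
  revert hP
  refine filtration_induction (motive := fun I => IsAssociatedPrime P (R ⧸ I) →
    ∃ T : Finset (Fin s), T.card = c ∧ IsAssociatedPrime P (R ⧸ Ideal.span (f '' T))) hcs
    (fun T hT => h.koszulRelations T (by lia)) (fun hP => ?_) fun I a T hT hcolon ih hP => ?_
  · have : Subsingleton (R ⧸ (⊤ : Ideal R)) := Submodule.Quotient.subsingleton_iff.2 rfl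
    exact absurd hP not_isAssociatedPrime_of_subsingleton
  · rcases associatedPrimes.subset_union_of_exact (colonQuotientMul_injective I a)
      (colonQuotientMul_exact I a) hP with hP | hP
    · exact ⟨T, hT, hcolon ▸ hP⟩
    · exact ih hP

variable [IsNoetherianRing R]

lemma RegularModSubsets.prod_compl_notMem (h : RegularModSubsets f c) {T : Finset (Fin s)}
    (hT : T.card = c) {P : Ideal R} (hP : IsAssociatedPrime P (R ⧸ Ideal.span (f '' T))) :
    ∏ j ∈ Tᶜ, f j ∉ P := by
  obtain ⟨hprime, y, hy⟩ := isAssociatedPrime_quotient_iff.1 hP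
  intro hmem
  obtain ⟨j, hj, hjP⟩ := (hprime.prod_mem_iff).1 hmem
  refine hprime.ne_top ((Ideal.eq_top_iff_one _).2 ((hy 1).2 ?_))
  rw [one_mul]
  exact h T hT.le j (Finset.mem_compl.1 hj) y ((hy _).1 hjP)

lemma RegularModSubsets.iInf_pow_eq (h : RegularModSubsets f c) (hcs : c ≤ s) (m : ℕ) :
    (⨅ T ∈ {T : Finset (Fin s) | T.card = c}, Ideal.span (f '' ↑T) ^ m)
      = symbolicMonomialIdeal f c m := by
  refine le_antisymm (fun x hx => ?_) (le_iInf₂ fun T hT => symbolicMonomialIdeal_le_pow f hT)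
  by_contra hcon
  obtain ⟨P, hP, hcol⟩ := exists_isAssociatedPrime_of_notMem hcon
  obtain ⟨T, hT, hPT⟩ := h.exists_isAssociatedPrime hcs hP
  refine h.prod_compl_notMem hT hPT (hPT.1.mem_of_pow_mem m (hcol _ ?_))
  simp only [Submodule.mem_iInf] at hx
  exact symbolicMonomialIdeal_one_pow_le f c m (prod_compl_pow_mul_mem f hT (hx T hT))

lemma RegularModSubsets.configIdeal_eq (h : RegularModSubsets f c) (hcs : c ≤ s) :
    configIdeal c f = symbolicMonomialIdeal f c 1 := by
  rw [← h.iInf_pow_eq hcs]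
  simp [configIdeal]

lemma RegularModSubsets.isAssociatedPrime_symbolicMonomialIdeal (h : RegularModSubsets f c)
    {T : Finset (Fin s)} (hT : T.card = c) {P : Ideal R}
    (hP : IsAssociatedPrime P (R ⧸ Ideal.span (f '' T))) :
    IsAssociatedPrime P (R ⧸ symbolicMonomialIdeal f c 1) := by
  obtain ⟨hprime, y, hy⟩ := isAssociatedPrime_quotient_iff.1 hP
  refine isAssociatedPrime_quotient_iff.2 ⟨hprime, (∏ j ∈ Tᶜ, f j) * y, fun r => ⟨fun hr => ?_,
    fun hr => ?_⟩⟩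
  · have := prod_compl_pow_mul_mem f hT (m := 1) (by simpa using (hy r).1 hr)
    rw [pow_one, pow_one] at this
    rwa [mul_left_comm]
  · have h1 := symbolicMonomialIdeal_le_pow f hT hr
    rw [pow_one, ← mul_assoc, ← hy] at h1
    exact (hprime.mem_or_mem h1).resolve_right (h.prod_compl_notMem hT hP)

lemma RegularModSubsets.symbolicPower_configIdeal (h : RegularModSubsets f c) (hcs : c ≤ s)
    (m : ℕ) : symbolicPower (configIdeal c f) m = symbolicMonomialIdeal f c m := by
  rw [h.configIdeal_eq hcs]
  ext x
  rw [mem_symbolicPower_iff]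
  constructor
  · intro hx
    by_contra hcon
    obtain ⟨P, hP, hcol⟩ := exists_isAssociatedPrime_of_notMem hcon
    obtain ⟨T, hT, hPT⟩ := h.exists_isAssociatedPrime hcs hP
    obtain ⟨r, hr, hrx⟩ := hx P (h.isAssociatedPrime_symbolicMonomialIdeal hT hPT)
    exact hr (hcol r (symbolicMonomialIdeal_one_pow_le f c m hrx))
  · intro hx P hP
    obtain ⟨T, hT, hPT⟩ := h.exists_isAssociatedPrime hcs hP
    exact ⟨_, fun hmem => h.prod_compl_notMem hT hPT (hPT.1.mem_of_pow_mem m hmem),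
      prod_compl_pow_mul_mem f hT (symbolicMonomialIdeal_le_pow f hT hx)⟩

end Symbolic

/-! ### Depth and dimension -/

section Ext

variable {R : Type} [CommRing R]

/-- The short complex `R ⧸ (I : a) → R ⧸ I → R ⧸ (I + (a))`. -/
def colonShortComplex (I : Ideal R) (a : R) : ShortComplex (ModuleCat.{0} R) :=
  ModuleCat.shortComplexOfCompEqZero (colonQuotientMul I a)
    (Submodule.factor (le_sup_left : I ≤ I ⊔ Ideal.span {a}))
    (colonQuotientMul_exact I a).linearMap_comp_eq_zero

lemma colonShortComplex_shortExact (I : Ideal R) (a : R) :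
    (colonShortComplex I a).ShortExact where
  exact := ModuleCat.shortComplex_exact _ (colonQuotientMul_exact I a)
  mono_f := (ModuleCat.mono_iff_injective _).2 (colonQuotientMul_injective I a)
  epi_g := (ModuleCat.epi_iff_surjective _).2
    (Submodule.factor_surjective (le_sup_left : I ≤ I ⊔ Ideal.span {a}))

lemma subsingleton_ext_quotient_of_colon (N : ModuleCat.{0} R) {I : Ideal R} {a : R} {i : ℕ}
    (h₁ : Subsingleton (Abelian.Ext N (ModuleCat.of R (R ⧸ I.colon {a})) i))
    (h₂ : Subsingleton (Abelian.Ext N (ModuleCat.of R (R ⧸ I ⊔ Ideal.span {a})) i)) :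
    Subsingleton (Abelian.Ext N (ModuleCat.of R (R ⧸ I)) i) :=
  AddCommGrpCat.subsingleton_of_isZero <| ShortComplex.Exact.isZero_of_both_zeros
    (Abelian.Ext.covariant_sequence_exact₂' N (colonShortComplex_shortExact I a) i)
    ((AddCommGrpCat.isZero_of_iff_subsingleton.2 h₁).eq_zero_of_src _)
    ((AddCommGrpCat.isZero_of_iff_subsingleton.2 h₂).eq_zero_of_tgt _)

lemma subsingleton_ext_quotient_sup_of_colon (N : ModuleCat.{0} R) {I : Ideal R} {a : R} {i : ℕ}
    (h₁ : Subsingleton (Abelian.Ext N (ModuleCat.of R (R ⧸ I)) i))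
    (h₂ : Subsingleton (Abelian.Ext N (ModuleCat.of R (R ⧸ I.colon {a})) (i + 1))) :
    Subsingleton (Abelian.Ext N (ModuleCat.of R (R ⧸ I ⊔ Ideal.span {a})) i) :=
  AddCommGrpCat.subsingleton_of_isZero <| ShortComplex.Exact.isZero_of_both_zeros
    (Abelian.Ext.covariant_sequence_exact₃' N (colonShortComplex_shortExact I a) i (i + 1) rfl)
    ((AddCommGrpCat.isZero_of_iff_subsingleton.2 h₁).eq_zero_of_src _)
    ((AddCommGrpCat.isZero_of_iff_subsingleton.2 h₂).eq_zero_of_tgt _)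

variable {s c : ℕ} {f : Fin s → R}

lemma RegularModSubsets.subsingleton_ext_span (h : RegularModSubsets f c) (N : ModuleCat.{0} R)
    {d : ℕ} (h₀ : ∀ i < d, Subsingleton
      (Abelian.Ext N (ModuleCat.of R (R ⧸ (⊥ : Ideal R))) i))
    (T : Finset (Fin s)) (hT : T.card ≤ c + 1) (i : ℕ) (hi : i + T.card < d) :
    Subsingleton (Abelian.Ext N (ModuleCat.of R (R ⧸ Ideal.span (f '' T))) i) := by
  induction T using Finset.induction_on generalizing i with
  | empty =>
    have hbot : Ideal.span (f '' ↑(∅ : Finset (Fin s))) = ⊥ := by simp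
    rw [hbot]
    exact h₀ i (by simpa using hi)
  | insert j T hj ih =>
    rw [Finset.card_insert_of_notMem hj] at hT hi
    have hcolon : (Ideal.span (f '' T)).colon {f j} = Ideal.span (f '' T) := by
      ext r
      rw [Submodule.mem_colon_singleton, smul_eq_mul]
      exact ⟨fun hr => h T (by lia) j hj r (by rwa [mul_comm]),
        fun hr => Ideal.mul_mem_right _ _ hr⟩
    have hsup : Ideal.span (f '' ↑(insert j T)) = Ideal.span (f '' T) ⊔ Ideal.span {f j} := by
      rw [Finset.coe_insert, Set.image_insert_eq, Ideal.span_insert, sup_comm]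
    rw [hsup]
    refine subsingleton_ext_quotient_sup_of_colon N (ih (by lia) i (by lia)) ?_
    rw [hcolon]
    exact ih (by lia) (i + 1) (by lia)

lemma RegularModSubsets.subsingleton_ext_symbolicMonomialIdeal (h : RegularModSubsets f c)
    (hcs : c ≤ s) (N : ModuleCat.{0} R) {d : ℕ} (h₀ : ∀ i < d, Subsingleton
      (Abelian.Ext N (ModuleCat.of R (R ⧸ (⊥ : Ideal R))) i)) (m i : ℕ) (hi : i + c < d) :
    Subsingleton (Abelian.Ext N (ModuleCat.of R (R ⧸ symbolicMonomialIdeal f c m)) i) := by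
  refine filtration_induction (motive := fun I => Subsingleton
    (Abelian.Ext N (ModuleCat.of R (R ⧸ I)) i)) hcs (fun T hT => h.koszulRelations T (by lia)) ?_
    fun I a T hT hcolon ih => subsingleton_ext_quotient_of_colon N ?_ ih
  · have : Subsingleton (ModuleCat.of R (R ⧸ (⊤ : Ideal R))) :=
      Submodule.Quotient.subsingleton_iff.2 rfl
    refine subsingleton_of_forall_eq 0 fun x => ?_
    rw [← x.comp_mk₀_id, (ModuleCat.isZero_of_subsingleton _).eq_zero_of_src (𝟙 _),
      Abelian.Ext.mk₀_zero, Abelian.Ext.comp_zero]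
  · rw [hcolon]
    exact h.subsingleton_ext_span N h₀ T (by lia) i (by lia)

end Ext

section Dimension

variable {R : Type} [CommRing R]

lemma length_le_supportDim_of_isRegular {M : Type} [AddCommGroup M] [Module R M]
    [Module.Finite R M] {rs : List R} (h : RingTheory.Sequence.IsRegular M rs) :
    (rs.length : WithBot ℕ∞) ≤ Module.supportDim R M := by
  induction rs generalizing M with
  | nil =>
    have := h.nontrivial
    have : Nonempty (Module.support R M) := Module.nonempty_support_of_nontrivial.to_subtype
    simpa [Module.supportDim] using Order.krullDim_nonneg
  | cons r rs ih =>
    rw [RingTheory.Sequence.isRegular_cons_iff] at h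
    refine le_trans ?_ (Module.supportDim_quotSMulTop_succ_le_of_notMem_minimalPrimes
      fun p hp => h.1.notMem_of_mem_minimalPrimes hp)
    rw [List.length_cons, Nat.cast_succ]
    gcongr
    exact ih h.2

variable {s c : ℕ} {f : Fin s → R}

lemma RegularModSubsets.ringKrullDim_quotient_span_add_le (h : RegularModSubsets f c)
    (T : Finset (Fin s)) (hT : T.card ≤ c + 1) :
    ringKrullDim (R ⧸ Ideal.span (f '' T)) + T.card ≤ ringKrullDim R := by
  induction T using Finset.induction_on with
  | empty => simpa using ringKrullDim_quotient_le _
  | insert j T hj ih =>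
    rw [Finset.card_insert_of_notMem hj] at hT ⊢
    refine le_trans ?_ (ih (by lia))
    rw [Nat.cast_succ, add_comm (T.card : WithBot ℕ∞) 1, ← add_assoc]
    gcongr
    have hle : Ideal.span (f '' T) ≤ Ideal.span (f '' ↑(insert j T)) :=
      Ideal.span_mono (Set.image_mono (by simp))
    refine ringKrullDim_succ_le_of_surjective (Ideal.Quotient.factor hle)
      (Ideal.Quotient.factor_surjective hle) (r := Ideal.Quotient.mk _ (f j)) ?_ ?_
    · refine mem_nonZeroDivisors_iff_left.2 fun x hx => ?_
      obtain ⟨r, rfl⟩ := Ideal.Quotient.mk_surjective x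
      rw [← map_mul, Ideal.Quotient.eq_zero_iff_mem] at hx
      exact Ideal.Quotient.eq_zero_iff_mem.2 (h T (by lia) j hj r hx)
    · rw [Ideal.Quotient.factor_mk, Ideal.Quotient.eq_zero_iff_mem]
      exact Ideal.subset_span ⟨j, by simp, rfl⟩

lemma ringKrullDim_quotient_le_of_forall_prime {J : Ideal R} {ι : Type} {K : ι → Ideal R}
    (hK : ∀ P : Ideal R, P.IsPrime → J ≤ P → ∃ i, K i ≤ P) {d : WithBot ℕ∞}
    (hd : ∀ i, ringKrullDim (R ⧸ K i) ≤ d) : ringKrullDim (R ⧸ J) ≤ d := by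
  rw [ringKrullDim_quotient]
  refine iSup_le fun q => ?_
  obtain ⟨i, hi⟩ := hK _ q.head.1.2 q.head.2
  refine le_trans ?_ (hd i)
  rw [ringKrullDim_quotient]
  let q' : LTSeries (PrimeSpectrum.zeroLocus (R := R) (K i)) :=
    { length := q.length
      toFun := fun j => ⟨(q j).1, hi.trans (q.monotone (Fin.zero_le j))⟩
      step := fun j => q.step j }
  exact le_iSup (fun p : LTSeries (PrimeSpectrum.zeroLocus (R := R) (K i)) =>
    (p.length : WithBot ℕ∞)) q'

lemma exists_span_le_of_symbolicMonomialIdeal_le [IsNoetherianRing R]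
    (h : RegularModSubsets f c) (hcs : c ≤ s) {m : ℕ} {P : Ideal R} (hP : P.IsPrime)
    (hle : symbolicMonomialIdeal f c m ≤ P) :
    ∃ T : {T : Finset (Fin s) // T.card = c}, Ideal.span (f '' T.1) ≤ P := by
  rw [← h.iInf_pow_eq hcs] at hle
  have hinf : (Finset.powersetCard c Finset.univ).inf
      (fun T : Finset (Fin s) => Ideal.span (f '' T) ^ m) ≤ P := by
    refine le_trans (le_iInf₂ fun T hT => Finset.inf_le ?_) hle
    simpa using hT
  obtain ⟨T, hT, hTP⟩ := hP.inf_le'.1 hinf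
  exact ⟨⟨T, by simpa using hT⟩, hP.le_of_pow_le hTP⟩

end Dimension

section Depth

variable {R : Type} [CommRing R]

lemma smul_top_quotient_lt_top {J 𝔪 : Ideal R} (h𝔪 : 𝔪 ≠ ⊤) (hJ : J ≤ 𝔪) :
    𝔪 • (⊤ : Submodule R (R ⧸ J)) < ⊤ := by
  refine lt_top_iff_ne_top.2 fun htop => h𝔪 ?_
  have h1 : 𝔪 • (⊤ : Submodule R (R ⧸ J)) = Submodule.map J.mkQ 𝔪 := by
    rw [← Submodule.range_mkQ J, ← Submodule.map_top, ← Submodule.map_smul'', smul_eq_mul,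
      Ideal.mul_top]
  rw [h1] at htop
  have h2 := congrArg (Submodule.comap J.mkQ) htop
  rwa [Submodule.comap_map_mkQ, Submodule.comap_top, sup_eq_right.2 hJ] at h2

lemma symbolicMonomialIdeal_le {s c m : ℕ} {f : Fin s → R} {𝔪 : Ideal R} (hcs : c ≤ s)
    (hf : ∀ i, f i ∈ 𝔪) (hm : 0 < m) : symbolicMonomialIdeal f c m ≤ 𝔪 := by
  obtain ⟨T, -, hT⟩ := Finset.exists_subset_card_eq (s := (Finset.univ : Finset (Fin s)))
    (by simpa using hcs)
  refine (symbolicMonomialIdeal_le_pow f hT).trans ((Ideal.pow_le_self hm.ne').trans ?_)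
  rw [Ideal.span_le]
  rintro _ ⟨i, -, rfl⟩
  exact hf i

variable [IsNoetherianRing R] {s c e m : ℕ} {f : Fin s → R} {𝔪 : Ideal R} {xs : List R}

lemma RegularModSubsets.exists_isRegular_quotient (h : RegularModSubsets f c) (hcs : c ≤ s)
    (h𝔪 : 𝔪 ≠ ⊤) (hf : ∀ i, f i ∈ 𝔪) (hm : 0 < m)
    (hxs : RingTheory.Sequence.IsRegular (R ⧸ (⊥ : Ideal R)) xs) (hmem : ∀ r ∈ xs, r ∈ 𝔪)
    (hlen : xs.length = e + c) :
    ∃ rs : List R, rs.length = e ∧ (∀ r ∈ rs, r ∈ 𝔪) ∧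
      RingTheory.Sequence.IsRegular (R ⧸ symbolicMonomialIdeal f c m) rs := by
  have hsupp : Module.support R (ModuleCat.of R (R ⧸ 𝔪)) = PrimeSpectrum.zeroLocus 𝔪 := by
    rw [Module.support_eq_zeroLocus, Ideal.annihilator_quotient]
  have hbot := ModuleCat.subsingleton_ext_of_exists_isRegular 𝔪 (ModuleCat.of R (R ⧸ 𝔪)) hsupp.le
    (ModuleCat.of R (R ⧸ (⊥ : Ideal R))) (smul_top_quotient_lt_top h𝔪 bot_le) xs hmem hxs
  exact ModuleCat.exists_isRegular_of_exists_subsingleton_ext 𝔪 e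
    (ModuleCat.of R (R ⧸ symbolicMonomialIdeal f c m))
    (smul_top_quotient_lt_top h𝔪 (symbolicMonomialIdeal_le hcs hf hm))
    (ModuleCat.of R (R ⧸ 𝔪)) hsupp
    fun i hi => h.subsingleton_ext_symbolicMonomialIdeal hcs _ hbot m i (by lia)

lemma RegularModSubsets.idealDepth_eq_ringKrullDim (h : RegularModSubsets f c) (hcs : c ≤ s)
    (h𝔪 : 𝔪 ≠ ⊤) (hf : ∀ i, f i ∈ 𝔪) (hm : 0 < m)
    (hxs : RingTheory.Sequence.IsRegular (R ⧸ (⊥ : Ideal R)) xs) (hmem : ∀ r ∈ xs, r ∈ 𝔪)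
    (hlen : xs.length = e + c) (hR : ringKrullDim R = ((e + c : ℕ) : WithBot ℕ∞)) :
    (idealDepth 𝔪 (R ⧸ symbolicMonomialIdeal f c m) : WithBot ℕ∞)
      = ringKrullDim (R ⧸ symbolicMonomialIdeal f c m) := by
  obtain ⟨rs, hrslen, hrsmem, hrs⟩ := h.exists_isRegular_quotient hcs h𝔪 hf hm hxs hmem hlen
  have hbound : ∀ rs : List R,
      RingTheory.Sequence.IsRegular (R ⧸ symbolicMonomialIdeal f c m) rs →
      (rs.length : WithBot ℕ∞) ≤ ringKrullDim (R ⧸ symbolicMonomialIdeal f c m) :=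
    fun rs hrs => (length_le_supportDim_of_isRegular hrs).trans_eq
      (Module.supportDim_quotient_eq_ringKrullDim _)
  have hdim : ringKrullDim (R ⧸ symbolicMonomialIdeal f c m) = (e : WithBot ℕ∞) := by
    refine le_antisymm (ringKrullDim_quotient_le_of_forall_prime
      (fun P hP hPle => exists_span_le_of_symbolicMonomialIdeal_le h hcs hP hPle)
      fun T => ?_) (hrslen ▸ hbound rs hrs)
    have h1 := h.ringKrullDim_quotient_span_add_le T.1 (T.2.le.trans (Nat.le_succ c))
    rw [T.2, hR, Nat.cast_add] at h1
    exact ENat.WithBot.add_le_add_natCast_right_iff.1 h1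
  have hdepth : idealDepth 𝔪 (R ⧸ symbolicMonomialIdeal f c m) = (e : ℕ∞) := by
    refine le_antisymm (sSup_le ?_) (le_sSup ⟨rs, by rw [hrslen], hrsmem, hrs⟩)
    rintro _ ⟨rs', rfl, -, hrs'⟩
    have := hbound rs' hrs'
    rw [hdim] at this
    exact_mod_cast this
  rw [hdim, hdepth]
  rfl

end Depth

section Polynomial

variable {k : Type} [Field k] {σ : Type}

lemma mem_span_X_image_of_X_mul_mem {S : Set σ} {j : σ} (hj : j ∉ S) {p : MvPolynomial σ k}
    (hp : X j * p ∈ Ideal.span (X '' S : Set (MvPolynomial σ k))) :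
    p ∈ Ideal.span (X '' S : Set (MvPolynomial σ k)) := by
  rw [mem_ideal_span_X_image] at hp ⊢
  intro e he
  obtain ⟨i, hi, hne⟩ := hp (Finsupp.single j 1 + e) (by
    rwa [mem_support_iff, coeff_X_mul, ← mem_support_iff])
  have hij : j ≠ i := fun h => hj (h ▸ hi)
  exact ⟨i, hi, by simpa [hij] using hne⟩

lemma isWeaklyRegular_map_X (l : List σ) (hl : l.Nodup) :
    RingTheory.Sequence.IsWeaklyRegular (MvPolynomial σ k)
      (l.map (X : σ → MvPolynomial σ k)) := by
  induction l using List.reverseRecOn with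
  | nil => simp
  | append_singleton l j ih =>
    rw [List.nodup_append] at hl
    have hj : j ∉ {i | i ∈ l} := fun h => hl.2.2 j h j (by simp) rfl
    rw [List.map_append, RingTheory.Sequence.isWeaklyRegular_append_iff, List.map_singleton,
      RingTheory.Sequence.isWeaklyRegular_singleton_iff]
    refine ⟨ih hl.1, ?_⟩
    have hspan : (Ideal.ofList (l.map (X : σ → MvPolynomial σ k)) • ⊤ :
        Submodule (MvPolynomial σ k) (MvPolynomial σ k)) = Ideal.span (X '' {i | i ∈ l}) := by
      rw [smul_eq_mul, Ideal.mul_top, Ideal.ofList]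
      congr 1
      ext x
      simp
    rw [hspan]
    refine IsSMulRegular.of_right_eq_zero_of_smul fun x hx => ?_
    obtain ⟨p, rfl⟩ := Submodule.Quotient.mk_surjective _ x
    rw [← Submodule.Quotient.mk_smul, Submodule.Quotient.mk_eq_zero] at hx
    exact (Submodule.Quotient.mk_eq_zero _).2 (mem_span_X_image_of_X_mul_mem hj hx)

lemma mem_irrelevantIdeal_iff {p : MvPolynomial σ k} :
    p ∈ irrelevantIdeal k σ ↔ coeff 0 p = 0 := by
  rw [irrelevantIdeal, ← Set.image_univ, mem_ideal_span_X_image]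
  constructor
  · intro h
    by_contra hne
    obtain ⟨i, -, hi⟩ := h 0 (mem_support_iff.2 hne)
    exact hi rfl
  · intro h e he
    have hne : e ≠ 0 := by
      rintro rfl
      exact mem_support_iff.1 he h
    obtain ⟨i, hi⟩ := Finsupp.ne_iff.1 hne
    exact ⟨i, Set.mem_univ i, hi⟩

lemma irrelevantIdeal_ne_top : irrelevantIdeal k σ ≠ ⊤ := by
  rw [Ne, Ideal.eq_top_iff_one, mem_irrelevantIdeal_iff]
  simp

lemma isRegular_map_X_quotient_bot {n : ℕ} :
    RingTheory.Sequence.IsRegular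
      (MvPolynomial (Fin (n + 1)) k ⧸ (⊥ : Ideal (MvPolynomial (Fin (n + 1)) k)))
      ((List.finRange (n + 1)).map (X : Fin (n + 1) → MvPolynomial (Fin (n + 1)) k)) := by
  rw [(Submodule.quotEquivOfEqBot _ rfl).isRegular_congr]
  refine ⟨isWeaklyRegular_map_X _ (List.nodup_finRange _), fun htop => ?_⟩
  refine irrelevantIdeal_ne_top (k := k) (σ := Fin (n + 1)) (top_le_iff.1 (htop.le.trans ?_))
  rw [smul_eq_mul, Ideal.mul_top, Ideal.ofList, Ideal.span_le]
  intro x hx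
  obtain ⟨i, -, rfl⟩ := List.mem_map.1 hx
  exact Ideal.subset_span ⟨i, rfl⟩

lemma MvPolynomial.IsHomogeneous.mem_irrelevantIdeal {p : MvPolynomial σ k} {d : ℕ}
    (hp : p.IsHomogeneous d) (hu : ¬ IsUnit p) : p ∈ irrelevantIdeal k σ := by
  rw [mem_irrelevantIdeal_iff]
  by_contra hne
  have hd : d = 0 := by simpa using (hp hne).symm
  subst hd
  have hC := totalDegree_eq_zero_iff_eq_C.1 (Nat.le_zero.1 hp.totalDegree_le)
  rw [hC] at hu
  exact hu ((isUnit_iff_ne_zero.2 hne).map C)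

lemma SubsetsRegular.not_isUnit {R : Type} [CommRing R] {s c : ℕ} {f : Fin s → R}
    (h : SubsetsRegular f (c + 1)) (i : Fin s) : ¬ IsUnit (f i) := by
  intro hu
  refine (h [i] (by simp) (by simp)).top_ne_smul ?_
  rw [List.map_singleton, Ideal.ofList_singleton, Ideal.span_singleton_eq_top.2 hu,
    Submodule.top_smul]

lemma RegularModSubsets.isCMQuotient {n s c : ℕ} {f : Fin s → MvPolynomial (Fin (n + 1)) k}
    (h : RegularModSubsets f c) (hf : ∀ i, f i ∈ irrelevantIdeal k (Fin (n + 1)))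
    (hcn : c ≤ n) (hcs : c ≤ s) {m : ℕ} (hm : 0 < m) :
    IsCMQuotient (symbolicMonomialIdeal f c m) := by
  refine h.idealDepth_eq_ringKrullDim hcs (irrelevantIdeal_ne_top) hf hm
    (e := n + 1 - c) isRegular_map_X_quotient_bot ?_ ?_ ?_
  · intro r hr
    obtain ⟨i, -, rfl⟩ := List.mem_map.1 hr
    exact Ideal.subset_span ⟨i, rfl⟩
  · rw [List.length_map, List.length_finRange]
    lia
  · rw [MvPolynomial.ringKrullDim_of_isNoetherianRing, ringKrullDim_eq_zero_of_field, zero_add,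
      Nat.card_fin, Nat.sub_add_cancel (by lia)]

end Polynomial

theorem statement14 (k : Type) [Field k] [Infinite k] (n s c : ℕ)
    (hc1 : 1 ≤ c) (hcn : c ≤ n) (hcs : c ≤ s)
    (f : Fin s → MvPolynomial (Fin (n + 1)) k) (d : Fin s → ℕ)
    (hdeg : ∀ i, (f i).IsHomogeneous (d i))
    (hreg : SubsetsRegular f (c + 1))
    (m : ℕ) (hm : 0 < m) :
    symbolicPower (configIdeal c f) m
        = (⨅ T ∈ {T : Finset (Fin s) | T.card = c}, (Ideal.span (f '' ↑T)) ^ m) ∧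
      IsCMQuotient (symbolicPower (configIdeal c f) m) ∧
      ∃ T : Set (Fin s →₀ ℕ),
        symbolicPower (configIdeal c f) m
          = Ideal.span ((fun e : Fin s →₀ ℕ => e.prod fun i t => f i ^ t) '' T) := by
  have h := hreg.regularModSubsets
  rw [h.symbolicPower_configIdeal hcs m]
  exact ⟨(h.iInf_pow_eq hcs m).symm,
    h.isCMQuotient (fun i => (hdeg i).mem_irrelevantIdeal (hreg.not_isUnit i)) hcn hcs hm,
    _, symbolicMonomialIdeal_eq_span_finsupp_prod f c m⟩
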